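/- Let M = (M_i)_{i∈I} be a POVM on a finite-dimensional complex Hilbert space E with d := |I| ≥ 2 outcomes, and let 0 < ε < 1. Then for every n with n > 16(log d)²·log(1/ε) and every density matrix ψ on E^{⊗n}, the output distribution M^{⊗n}(ψ) on I^n, given by i^n ↦ tr(ψ·(M_{i₁} ⊗ ⋯ ⊗ M_{iₙ})), satisfies H_min^ε(M^{⊗n}(ψ)) ≥ n·Ĥ(M) − 8(log d)·√(n·log(1/ε)). -/

import Mathlib

open scoped BigOperators ComplexOrder

noncomputable section

/-- A probability distribution on a finite type. -/
def IsProbDist {I : Type*} [Fintype I] (p : I → ℝ) : Prop :=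
  (∀ i, 0 ≤ p i) ∧ ∑ i, p i = 1

/-- Shannon entropy (base 2), with the convention 0·log 0 = 0 (automatic since
`Real.logb 2 0 = 0`). -/
def shannonEntropy {I : Type*} [Fintype I] (p : I → ℝ) : ℝ :=
  - ∑ i, p i * Real.logb 2 (p i)

/-- A density matrix: positive semidefinite with trace 1. -/
def IsDensityMatrix {n : Type*} [Fintype n] (ρ : Matrix n n ℂ) : Prop :=
  ρ.PosSemidef ∧ ρ.trace = 1

/-- A POVM: positive semidefinite elements summing to the identity. -/
def IsPOVM {n J : Type*} [Fintype n] [DecidableEq n] [Fintype J]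
    (Q : J → Matrix n n ℂ) : Prop :=
  (∀ j, (Q j).PosSemidef) ∧ ∑ j, Q j = 1

/-- The `n`-fold tensor power of a family of matrices: for a word `iv : Fin n → I`,
the Kronecker product `M (iv 0) ⊗ ⋯ ⊗ M (iv (n-1))`, realized on the index set
`Fin n → Fin D`. -/
def tensorPowFam {D : ℕ} {I : Type*} (M : I → Matrix (Fin D) (Fin D) ℂ) (n : ℕ) :
    (Fin n → I) → Matrix (Fin n → Fin D) (Fin n → Fin D) ℂ :=
  fun iv => Matrix.of fun x y => ∏ k, M (iv k) (x k) (y k)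

/-- Min-entropy (base 2) of a probability distribution: `−log max_x q x`. -/
def distHmin {I : Type*} [Fintype I] (q : I → ℝ) : ℝ :=
  - Real.logb 2 (⨆ i, q i)

/-- Smooth min-entropy (base 2) of a probability distribution, smoothing in total
variation distance. -/
def smoothHminDist {I : Type*} [Fintype I] (ε : ℝ) (q : I → ℝ) : ℝ :=
  sSup { h : ℝ | ∃ q' : I → ℝ, IsProbDist q' ∧
    (1/2) * ∑ i, |q i - q' i| ≤ ε ∧ h = distHmin q' }

/-- Minimum output entropy `Ĥ(M)` of the qc-channel associated with a POVM `M`. -/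
def minOutEntropy {n I : Type*} [Fintype n] [Fintype I] (M : I → Matrix n n ℂ) : ℝ :=
  sInf { h : ℝ | ∃ ψ : Matrix n n ℂ, IsDensityMatrix ψ ∧
    h = shannonEntropy (fun i => ((ψ * M i).trace).re) }

lemma exp_neg_quad {x : ℝ} (hx : 0 ≤ x) : Real.exp (-x) ≤ 1 - x + x ^ 2 / 2 := by
  have h1 := Real.quadratic_le_exp_of_nonneg hx
  have h2 : Real.exp (-x) * Real.exp x = 1 := by rw [← Real.exp_add]; simp
  have h3 : 0 < Real.exp (-x) := Real.exp_pos _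
  have h4 : 0 < 1 + x + x ^ 2 / 2 := by positivity
  have h5 : Real.exp (-x) * (1 + x + x ^ 2 / 2) ≤ 1 := by
    exact (mul_le_mul_of_nonneg_left h1 h3.le).trans h2.le
  have h6 : 1 ≤ (1 - x + x ^ 2 / 2) * (1 + x + x ^ 2 / 2) := by
    have : 0 ≤ x ^ 4 := by positivity
    nlinarith
  exact le_of_mul_le_mul_right (h5.trans h6) h4

lemma term_var {d r : ℝ} (hd : 2 ≤ d) (h0 : 0 ≤ r) (h1 : r ≤ 1) :
    r * (Real.log r) ^ 2 ≤ r * (4 * (Real.log d) ^ 2) + 16 / d := by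
  have hd0 : 0 < d := by linarith
  rcases h0.eq_or_lt with h | h0
  · subst h; simp; positivity
  have hl : Real.log r ≤ 0 := Real.log_nonpos h0.le h1
  by_cases hr : 1 / d ^ 2 ≤ r
  · have h2 : -(2 * Real.log d) ≤ Real.log r := by
      have := Real.log_le_log (by positivity) hr
      rw [Real.log_div (by norm_num) (by positivity), Real.log_pow] at this
      simp at this; linarith
    have hld : 0 ≤ Real.log d := Real.log_nonneg (by linarith)
    have h3 : (Real.log r) ^ 2 ≤ 4 * (Real.log d) ^ 2 := by nlinarith
    have h4 := mul_le_mul_of_nonneg_left h3 h0.le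
    have : 0 ≤ 16 / d := by positivity
    linarith
  · push Not at hr
    set u := Real.sqrt (Real.sqrt r) with hu
    have hs : 0 < Real.sqrt r := Real.sqrt_pos.2 h0
    have hu0 : 0 < u := Real.sqrt_pos.2 hs
    have hu2 : u ^ 2 = Real.sqrt r := Real.sq_sqrt hs.le
    have hu4 : u ^ 4 = r := by
      rw [show u ^ 4 = (u ^ 2) ^ 2 by ring, hu2, Real.sq_sqrt h0.le]
    have hu1 : u ≤ 1 := by
      by_contra hc
      push Not at hc
      have := one_lt_pow₀ hc (n := 4) (by norm_num)
      linarith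
    have ha := Real.abs_log_mul_self_lt u hu0 hu1
    have hb : (Real.log u * u) ^ 2 ≤ 1 := by
      rw [sq_le_one_iff_abs_le_one]; exact ha.le
    have hlr : Real.log r = 4 * Real.log u := by rw [← hu4, Real.log_pow]; norm_num
    have hsd : u ^ 2 ≤ 1 / d := by
      rw [hu2]
      apply Real.sqrt_le_iff.2
      refine ⟨by positivity, ?_⟩
      rw [div_pow, one_pow]; exact hr.le
    have e : r * Real.log r ^ 2 = 16 * (u ^ 2 * (Real.log u * u) ^ 2) := by
      rw [hlr, ← hu4]; ring
    have h6 : u ^ 2 * (Real.log u * u) ^ 2 ≤ 1 / d * 1 :=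
      mul_le_mul hsd hb (sq_nonneg _) (by positivity)
    rw [e]
    have : 0 ≤ r * (4 * (Real.log d) ^ 2) := by positivity
    have e2 : 16 / d = 16 * (1 / d * 1) := by ring
    rw [e2]; linarith

lemma prob_le_one {I : Type*} [Fintype I] {r : I → ℝ} (hr : IsProbDist r) (i : I) : r i ≤ 1 := by
  rw [← hr.2]
  exact Finset.single_le_sum (fun j _ => hr.1 j) (Finset.mem_univ i)

lemma entropy_mul_log {I : Type*} [Fintype I] (r : I → ℝ) :
    shannonEntropy r * Real.log 2 = - ∑ i, r i * Real.log (r i) := by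
  have : Real.log 2 ≠ 0 := (Real.log_pos (by norm_num)).ne'
  unfold shannonEntropy
  rw [neg_mul, Finset.sum_mul]
  congr 1
  refine Finset.sum_congr rfl fun i _ => ?_
  unfold Real.logb
  field_simp

lemma entropy_nonneg {I : Type*} [Fintype I] {r : I → ℝ} (hr : IsProbDist r) :
    0 ≤ shannonEntropy r := by
  unfold shannonEntropy
  rw [← Finset.sum_neg_distrib]
  refine Finset.sum_nonneg fun i _ => ?_
  have : Real.logb 2 (r i) ≤ 0 :=
    Real.logb_nonpos (by norm_num) (hr.1 i) (prob_le_one hr i)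
  have := mul_nonneg (hr.1 i) (neg_nonneg.2 this)
  linarith

lemma entropy_le {I : Type*} [Fintype I] {r : I → ℝ} (hr : IsProbDist r)
    (hd : 2 ≤ Fintype.card I) :
    shannonEntropy r * Real.log 2 ≤ Real.log (Fintype.card I) := by
  rw [entropy_mul_log]
  set d : ℝ := (Fintype.card I : ℝ) with hdd
  have hd0 : 0 < d := by rw [hdd]; exact_mod_cast (by omega : 0 < Fintype.card I)
  have key : ∀ i, r i * (-Real.log (r i) - Real.log d) ≤ 1 / d - r i := by
    intro i
    rcases (hr.1 i).eq_or_lt with h | h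
    · rw [← h]; simp; exact hd0.le
    have h1 := Real.log_le_sub_one_of_pos (x := (r i * d)⁻¹) (by positivity)
    rw [Real.log_inv, Real.log_mul h.ne' hd0.ne'] at h1
    have h2 := mul_le_mul_of_nonneg_left h1 h.le
    have e : r i * ((r i * d)⁻¹ - 1) = 1 / d - r i := by field_simp
    rw [e] at h2
    linarith
  have := Finset.sum_le_sum (s := Finset.univ) (fun i _ => key i)
  simp only [mul_sub, Finset.sum_sub_distrib, ← Finset.sum_mul, hr.2, mul_neg,
    Finset.sum_neg_distrib, Finset.sum_const, Finset.card_univ, nsmul_eq_mul] at this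
  rw [← hdd] at this
  have e : d * (1 / d) = 1 := by field_simp
  rw [e] at this
  linarith

lemma mgf_bound {I : Type*} [Fintype I] {r : I → ℝ} (hr : IsProbDist r)
    (hd : 2 ≤ Fintype.card I) {s : ℝ} (hs : 0 < s) :
    ∑ i, (r i) ^ (1 + s) ≤ Real.exp (-s * (shannonEntropy r * Real.log 2)
      + s ^ 2 * (2 * (Real.log (Fintype.card I)) ^ 2 + 8)) := by
  set d : ℝ := (Fintype.card I : ℝ) with hdd
  have hd2 : 2 ≤ d := by rw [hdd]; exact_mod_cast hd
  have key : ∀ i, (r i) ^ (1 + s) ≤ r i + s * (r i * Real.log (r i))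
      + s ^ 2 / 2 * (r i * (4 * (Real.log d) ^ 2) + 16 / d) := by
    intro i
    rcases (hr.1 i).eq_or_lt with h | h
    · rw [← h, Real.zero_rpow (by linarith)]; simp; positivity
    have hl : Real.log (r i) ≤ 0 := Real.log_nonpos h.le (prob_le_one hr i)
    have h1 := exp_neg_quad (x := s * (-Real.log (r i))) (mul_nonneg hs.le (by linarith))
    have h2 := term_var hd2 h.le (prob_le_one hr i)
    have e : (r i) ^ (1 + s) = r i * Real.exp (-(s * (-Real.log (r i)))) := by
      rw [Real.rpow_add h, Real.rpow_one, Real.rpow_def_of_pos h]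
      congr 2; ring
    rw [e]
    have h3 := mul_le_mul_of_nonneg_left h1 h.le
    have h4 := mul_le_mul_of_nonneg_left h2 (by positivity : 0 ≤ s ^ 2 / 2)
    refine h3.trans ?_
    nlinarith
  have h := Finset.sum_le_sum (s := Finset.univ) (fun i _ => key i)
  refine h.trans ?_
  simp only [Finset.sum_add_distrib, ← Finset.mul_sum, ← Finset.sum_mul, hr.2,
    Finset.sum_const, Finset.card_univ, nsmul_eq_mul]
  rw [← hdd, entropy_mul_log]
  have e : d * (16 / d) = 16 := by field_simp
  rw [e]
  refine le_trans (le_of_eq ?_) (Real.add_one_le_exp _)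
  ring

open Matrix in
lemma trace_mul_nonneg {m : Type*} [Fintype m] [DecidableEq m] {A B : Matrix m m ℂ}
    (hA : A.PosSemidef) (hB : B.PosSemidef) : 0 ≤ (A * B).trace := by
  open scoped MatrixOrder in
  obtain ⟨X, rfl⟩ := CStarAlgebra.nonneg_iff_eq_star_mul_self.mp hB.nonneg
  rw [← Matrix.mul_assoc, Matrix.trace_mul_comm, ← Matrix.mul_assoc]
  exact (hA.mul_mul_conjTranspose_same X).trace_nonneg

/-- tensor product of a tuple of matrices -/
def tProd {D n : ℕ} (A : Fin n → Matrix (Fin D) (Fin D) ℂ) :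
    Matrix (Fin n → Fin D) (Fin n → Fin D) ℂ :=
  Matrix.of fun x y => ∏ k, A k (x k) (y k)

open Matrix in
lemma tProd_posSemidef {D n : ℕ} (A : Fin n → Matrix (Fin D) (Fin D) ℂ)
    (hA : ∀ k, (A k).PosSemidef) : (tProd A).PosSemidef := by
  have : ∀ k, ∃ X : Matrix (Fin D) (Fin D) ℂ, A k = Xᴴ * X := by
    intro k
    open scoped MatrixOrder in
    exact CStarAlgebra.nonneg_iff_eq_star_mul_self.mp (hA k).nonneg
  choose X hX using this
  have e : tProd A = (tProd X)ᴴ * tProd X := by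
    ext x y
    simp only [tProd, Matrix.of_apply, Matrix.mul_apply, Matrix.conjTranspose_apply, hX,
      Finset.prod_univ_sum, star_prod, ← Finset.prod_mul_distrib]
    simp
  rw [e]
  exact Matrix.posSemidef_conjTranspose_mul_self _

/-- the multilinear functional A ↦ tr(ψ (A₁ ⊗ ⋯ ⊗ Aₙ)) -/
def stateFun {D n : ℕ} (ψ : Matrix (Fin n → Fin D) (Fin n → Fin D) ℂ) :
    MultilinearMap ℂ (fun _ : Fin n => Matrix (Fin D) (Fin D) ℂ) ℂ :=
  ∑ x, ∑ y, ψ x y • (MultilinearMap.mkPiAlgebra ℂ (Fin n) ℂ).compLinearMap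
    (fun k => Matrix.entryLinearMap ℂ ℂ (y k) (x k))

lemma stateFun_apply {D n : ℕ} (ψ : Matrix (Fin n → Fin D) (Fin n → Fin D) ℂ)
    (A : Fin n → Matrix (Fin D) (Fin D) ℂ) : stateFun ψ A = (ψ * tProd A).trace := by
  simp [stateFun, tProd, Matrix.trace, Matrix.mul_apply]

/-- representing matrix of a linear functional on matrices -/
def repMat {D : ℕ} (f : Matrix (Fin D) (Fin D) ℂ →ₗ[ℂ] ℂ) : Matrix (Fin D) (Fin D) ℂ :=
  Matrix.of fun a b => f (Matrix.single b a 1)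

lemma repMat_trace {D : ℕ} (f : Matrix (Fin D) (Fin D) ℂ →ₗ[ℂ] ℂ)
    (A : Matrix (Fin D) (Fin D) ℂ) : (repMat f * A).trace = f A := by
  conv_rhs => rw [Matrix.matrix_eq_sum_single A]
  simp only [map_sum, Matrix.trace, Matrix.diag, Matrix.mul_apply, repMat, Matrix.of_apply]
  rw [Finset.sum_comm]
  refine Finset.sum_congr rfl fun i _ => Finset.sum_congr rfl fun j _ => ?_
  have : Matrix.single i j (A i j) = (A i j) • Matrix.single i j (1 : ℂ) := by
    rw [Matrix.smul_single]; simp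
  rw [this, map_smul, smul_eq_mul, mul_comm]

open Matrix in
lemma repMat_posSemidef {D : ℕ} (f : Matrix (Fin D) (Fin D) ℂ →ₗ[ℂ] ℂ)
    (hf : ∀ A : Matrix (Fin D) (Fin D) ℂ, A.PosSemidef → 0 ≤ f A) : (repMat f).PosSemidef := by
  have h0 : ∀ v : Fin D → ℂ, 0 ≤ star v ⬝ᵥ (repMat f *ᵥ v) := by
    intro v
    have e : star v ⬝ᵥ (repMat f *ᵥ v) = f (vecMulVec v (star v)) := by
      rw [← repMat_trace f, Matrix.mul_vecMulVec, Matrix.trace_vecMulVec, dotProduct_comm]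
    rw [e]
    exact hf _ (Matrix.posSemidef_vecMulVec_self_star v)
  rw [← Matrix.isPositive_toEuclideanLin_iff, LinearMap.isPositive_iff_complex]
  intro x
  have h1 : inner ℂ (Matrix.toEuclideanLin (repMat f) x) x
      = star (star x.ofLp ⬝ᵥ (repMat f *ᵥ x.ofLp)) := by
    rw [EuclideanSpace.inner_eq_star_dotProduct]
    simp [dotProduct, mul_comm]
  have h2 := h0 x.ofLp
  rw [Complex.nonneg_iff] at h2
  rw [h1]
  refine ⟨?_, ?_⟩
  · apply Complex.ext <;> simp [← h2.2]
  · simpa using h2.1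

lemma density_output {D : ℕ} {I : Type*} [Fintype I] {M : I → Matrix (Fin D) (Fin D) ℂ}
    (hM : IsPOVM M) {φ : Matrix (Fin D) (Fin D) ℂ} (hφ : IsDensityMatrix φ) :
    IsProbDist (fun i => ((φ * M i).trace).re) := by
  refine ⟨fun i => (Complex.nonneg_iff.1 (trace_mul_nonneg hφ.1 (hM.1 i))).1, ?_⟩
  rw [← Complex.re_sum, ← Matrix.trace_sum, ← Matrix.mul_sum, hM.2, Matrix.mul_one, hφ.2]
  simp

lemma minOut_le {D : ℕ} {I : Type*} [Fintype I] {M : I → Matrix (Fin D) (Fin D) ℂ}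
    (hM : IsPOVM M) {φ : Matrix (Fin D) (Fin D) ℂ} (hφ : IsDensityMatrix φ) :
    minOutEntropy M ≤ shannonEntropy (fun i => ((φ * M i).trace).re) := by
  refine csInf_le ⟨0, ?_⟩ ⟨φ, hφ, rfl⟩
  rintro _ ⟨χ, hχ, rfl⟩
  exact entropy_nonneg (density_output hM hχ)

/-- the per-letter factor -/
def letterB {D : ℕ} {I : Type*} [Fintype I] (M : I → Matrix (Fin D) (Fin D) ℂ) (s : ℝ) : ℝ :=
  Real.exp (-s * (minOutEntropy M * Real.log 2)
      + s ^ 2 * (2 * (Real.log (Fintype.card I)) ^ 2 + 8))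

lemma single_letter {D : ℕ} {I : Type*} [Fintype I] {M : I → Matrix (Fin D) (Fin D) ℂ}
    (hM : IsPOVM M) (hd : 2 ≤ Fintype.card I) {s : ℝ} (hs : 0 < s)
    (f : Matrix (Fin D) (Fin D) ℂ →ₗ[ℂ] ℂ)
    (hf : ∀ A : Matrix (Fin D) (Fin D) ℂ, A.PosSemidef → 0 ≤ f A) :
    ∑ i, ((f (M i)).re) ^ (1 + s) ≤ letterB M s * ((f 1).re) ^ (1 + s) := by
  have hq : ∀ i, 0 ≤ (f (M i)).re := fun i => (Complex.nonneg_iff.1 (hf _ (hM.1 i))).1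
  have h1 := Complex.nonneg_iff.1 (hf 1 Matrix.PosSemidef.one)
  have hsum : ∑ i, (f (M i)).re = (f 1).re := by
    rw [← Complex.re_sum, ← map_sum, hM.2]
  set T := (f 1).re with hT
  have hfT : f 1 = (T : ℂ) := Complex.ext (by simp [hT]) (by simpa using h1.2.symm)
  have hB : 0 < letterB M s := Real.exp_pos _
  rcases h1.1.eq_or_lt with h | h
  · have : ∀ i, (f (M i)).re = 0 := by
      intro i
      have := Finset.single_le_sum (fun j _ => hq j) (Finset.mem_univ i)
      rw [hsum, ← h] at this
      exact le_antisymm this (hq i)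
    simp only [this, Real.zero_rpow (by linarith : 1 + s ≠ 0), Finset.sum_const_zero]
    positivity
  · set φ : Matrix (Fin D) (Fin D) ℂ := ((T⁻¹ : ℝ) : ℂ) • repMat f with hφd
    have hφ : IsDensityMatrix φ := by
      refine ⟨(repMat_posSemidef f hf).smul (by
        rw [Complex.zero_le_real]; positivity), ?_⟩
      have := repMat_trace f 1
      rw [Matrix.mul_one] at this
      rw [hφd, Matrix.trace_smul, this, hfT, smul_eq_mul, ← Complex.ofReal_mul,
        inv_mul_cancel₀ h.ne', Complex.ofReal_one]
    have hr : ∀ i, ((φ * M i).trace).re = T⁻¹ * (f (M i)).re := by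
      intro i
      rw [hφd, Matrix.smul_mul, Matrix.trace_smul, repMat_trace, smul_eq_mul,
        Complex.re_ofReal_mul]
    have hm := mgf_bound (density_output hM hφ) hd hs
    have hB2 : ∑ i, (((φ * M i).trace).re) ^ (1 + s) ≤ letterB M s := by
      refine hm.trans (Real.exp_le_exp.2 ?_)
      have := mul_le_mul_of_nonneg_right (minOut_le hM hφ) (Real.log_pos (by norm_num : (1:ℝ) < 2)).le
      have := mul_le_mul_of_nonneg_left this hs.le
      linarith
    have e : ∀ i, ((f (M i)).re) ^ (1 + s) = (((φ * M i).trace).re) ^ (1 + s) * T ^ (1 + s) := by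
      intro i
      rw [hr, ← Real.mul_rpow (mul_nonneg (by positivity) (hq i)) h.le]
      congr 1
      field_simp
    simp only [e, ← Finset.sum_mul]
    exact mul_le_mul_of_nonneg_right hB2 (by positivity)

lemma multi_letter {D : ℕ} {I : Type*} [Fintype I] {M : I → Matrix (Fin D) (Fin D) ℂ}
    (hM : IsPOVM M) (hd : 2 ≤ Fintype.card I) {s : ℝ} (hs : 0 < s) (n : ℕ) :
    ∀ (F : MultilinearMap ℂ (fun _ : Fin n => Matrix (Fin D) (Fin D) ℂ) ℂ),
    (∀ A : Fin n → Matrix (Fin D) (Fin D) ℂ, (∀ k, (A k).PosSemidef) → 0 ≤ F A) →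
    ∑ w : Fin n → I, ((F (fun k => M (w k))).re) ^ (1 + s)
      ≤ letterB M s ^ n * ((F (fun _ => 1)).re) ^ (1 + s) := by
  induction n with
  | zero =>
    intro F hF
    simp only [Fintype.sum_unique, pow_zero, one_mul]
    apply le_of_eq
    congr 4
    exact Subsingleton.elim _ _
  | succ n ih =>
    intro F hF
    have hB : 0 < letterB M s := Real.exp_pos _
    have hc : ∀ (A : Matrix (Fin D) (Fin D) ℂ) (m : Fin n → Matrix (Fin D) (Fin D) ℂ),
        A.PosSemidef → (∀ k, (m k).PosSemidef) → 0 ≤ F.curryLeft A m := by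
      intro A m hA hm
      rw [MultilinearMap.curryLeft_apply]
      apply hF
      intro k
      refine Fin.cases ?_ (fun j => ?_) k
      · simpa using hA
      · simpa using hm j
    have e1 : ∑ w : Fin (n + 1) → I, ((F (fun k => M (w k))).re) ^ (1 + s)
        = ∑ w : Fin n → I, ∑ i, ((F.curryLeft (M i) (fun k => M (w k))).re) ^ (1 + s) := by
      rw [Finset.sum_comm, ← (Fin.consEquiv (fun _ => I)).sum_comp, Fintype.sum_prod_type]
      refine Finset.sum_congr rfl fun i _ => Finset.sum_congr rfl fun w _ => ?_
      rw [MultilinearMap.curryLeft_apply]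
      congr 3
      funext k
      refine Fin.cases ?_ (fun j => ?_) k <;> simp [Fin.consEquiv]
    rw [e1]
    have e2 : F (fun _ => 1) = F.curryLeft 1 (fun _ => 1) := by
      rw [MultilinearMap.curryLeft_apply]
      congr 1
      funext k
      refine Fin.cases ?_ (fun j => ?_) k <;> simp
    rw [e2]
    have h1 : ∀ w : Fin n → I, ∑ i, ((F.curryLeft (M i) (fun k => M (w k))).re) ^ (1 + s)
        ≤ letterB M s * ((F.curryLeft 1 (fun k => M (w k))).re) ^ (1 + s) := by
      intro w
      exact single_letter hM hd hs
        (f := { toFun := fun A => F.curryLeft A (fun k => M (w k))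
                map_add' := by intro A B; simp only [map_add, add_apply]
                map_smul' := by
                  intro c A; simp only [map_smul, smul_apply, RingHom.id_apply] })
        (fun A hA => hc A _ hA (fun k => hM.1 _))
    refine (Finset.sum_le_sum fun w _ => h1 w).trans ?_
    rw [← Finset.mul_sum, pow_succ', mul_assoc]
    exact mul_le_mul_of_nonneg_left
      (ih (F.curryLeft 1) (fun A hA => hc 1 A Matrix.PosSemidef.one hA)) hB.le

lemma smooth_of_tail {J : Type*} [Fintype J] {p : J → ℝ} (hp : IsProbDist p) {ε t : ℝ}
    (ht : 0 < t) (htd : 1 ≤ t * Fintype.card J)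
    (htail : ∑ j, (p j - min (p j) t) ≤ ε) :
    - Real.logb 2 t ≤ smoothHminDist ε p := by
  have hJ : Nonempty J := by
    by_contra h
    rw [not_nonempty_iff] at h
    have := hp.2
    simp at this
  set m : ℝ := ∑ j, min (p j) t with hm
  have hm1 : m ≤ 1 := by
    rw [← hp.2]; exact Finset.sum_le_sum fun j _ => min_le_left _ _
  obtain ⟨c, hc0, hc1, hc⟩ : ∃ c : ℝ, 0 ≤ c ∧ c ≤ 1 ∧ m + c * (t * Fintype.card J - m) = 1 := by
    rcases (sub_nonneg.2 (hm1.trans htd)).eq_or_lt with h | h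
    · exact ⟨0, le_rfl, zero_le_one, by linarith⟩
    · refine ⟨(1 - m) / (t * Fintype.card J - m), ?_, ?_, ?_⟩
      · exact div_nonneg (by linarith) h.le
      · rw [div_le_one h]; linarith
      · rw [div_mul_cancel₀ _ h.ne']; ring
  set q : J → ℝ := fun j => min (p j) t + c * (t - min (p j) t) with hq
  have hqt : ∀ j, q j ≤ t := by
    intro j
    have : min (p j) t ≤ t := min_le_right _ _
    simp only [hq]; nlinarith
  have hqm : ∀ j, min (p j) t ≤ q j := by
    intro j
    have : min (p j) t ≤ t := min_le_right _ _
    have := mul_nonneg hc0 (sub_nonneg.2 this)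
    simp only [hq]; linarith
  have hqp : IsProbDist q := by
    refine ⟨fun j => (le_min (hp.1 j) ht.le).trans (hqm j), ?_⟩
    simp only [hq, Finset.sum_add_distrib, ← Finset.mul_sum, Finset.sum_sub_distrib,
      Finset.sum_const, Finset.card_univ, nsmul_eq_mul]
    rw [← hm, ← hc]; ring
  have hsup_pos : ∀ q' : J → ℝ, IsProbDist q' → (1 : ℝ) / Fintype.card J ≤ ⨆ j, q' j := by
    intro q' hq'
    have hcard : (0:ℝ) < Fintype.card J := by exact_mod_cast Fintype.card_pos
    rw [div_le_iff₀ hcard, ← hq'.2]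
    have := Finset.sum_le_sum (s := Finset.univ)
      (fun j _ => le_ciSup (Set.finite_range q').bddAbove j)
    simpa [mul_comm] using this
  have hcard : (0:ℝ) < 1 / Fintype.card J := by
    have : 0 < Fintype.card J := Fintype.card_pos
    positivity
  have hb : BddAbove { h : ℝ | ∃ q' : J → ℝ, IsProbDist q' ∧
    (1/2) * ∑ i, |p i - q' i| ≤ ε ∧ h = distHmin q' } := by
    refine ⟨-Real.logb 2 (1 / Fintype.card J), ?_⟩
    rintro _ ⟨q', hq', -, rfl⟩
    exact neg_le_neg (Real.logb_le_logb_of_le (by norm_num) hcard (hsup_pos q' hq'))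
  have htv : (1/2) * ∑ i, |p i - q i| ≤ ε := by
    have h1 : ∀ j, |p j - q j| ≤ 2 * (p j - min (p j) t) - (p j - q j) := by
      intro j
      have := hqm j
      have := min_le_left (p j) t
      rw [abs_le]; constructor <;> linarith
    have h2 := Finset.sum_le_sum (s := Finset.univ) (fun j _ => h1 j)
    rw [Finset.sum_sub_distrib, ← Finset.mul_sum, Finset.sum_sub_distrib (f := p) (g := q),
      hp.2, hqp.2] at h2
    linarith
  refine le_trans ?_ (le_csSup hb ⟨q, hqp, htv, rfl⟩)
  exact neg_le_neg (Real.logb_le_logb_of_le (by norm_num) (hcard.trans_le (hsup_pos q hqp))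
    (ciSup_le hqt))

/-- high-order min-entropy uncertainty relation, simplified form:
for `n > 16(log d)²·log(1/ε)`,
`H_min^ε(M^{⊗n}(ψ)) ≥ n·Ĥ(M) − 8(log d)·√(n·log(1/ε))`. -/
theorem smooth_min_entropy_tensor_povm_sqrt
    {D : ℕ} {I : Type} [Fintype I] (M : I → Matrix (Fin D) (Fin D) ℂ)
    (hM : IsPOVM M) (hd : 2 ≤ Fintype.card I)
    (ε : ℝ) (hε0 : 0 < ε) (hε1 : ε < 1)
    (n : ℕ) (hn : 16 * (Real.logb 2 (Fintype.card I)) ^ 2 * Real.logb 2 (1 / ε) < n)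
    (ψ : Matrix (Fin n → Fin D) (Fin n → Fin D) ℂ) (hψ : IsDensityMatrix ψ) :
    smoothHminDist ε (fun iv : Fin n → I => ((ψ * tensorPowFam M n iv).trace).re)
    ≥ n * minOutEntropy M
      - 8 * Real.logb 2 (Fintype.card I) * Real.sqrt (n * Real.logb 2 (1 / ε)) := by
  set d : ℝ := (Fintype.card I : ℝ) with hdd
  have hd2 : 2 ≤ d := by rw [hdd]; exact_mod_cast hd
  set L := Real.logb 2 d with hL
  set l := Real.logb 2 (1 / ε) with hl
  set h := minOutEntropy M with hh
  have hlog2 : 0 < Real.log 2 := Real.log_pos (by norm_num)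
  have hL1 : 1 ≤ L := by
    rw [hL, Real.le_logb_iff_rpow_le (by norm_num) (by linarith)]; simpa using hd2
  have hl0 : 0 < l := Real.logb_pos (by norm_num) (by rw [lt_div_iff₀ hε0]; linarith)
  have hn0 : (0 : ℝ) < n := lt_of_le_of_lt (by positivity) hn
  have hLd : Real.log d = L * Real.log 2 := by
    rw [hL]; unfold Real.logb; field_simp
  have hle : Real.log ε = -(l * Real.log 2) := by
    rw [hl]; unfold Real.logb
    rw [one_div, Real.log_inv]; field_simp
  -- the output distribution
  set p : (Fin n → I) → ℝ := fun iv => ((ψ * tensorPowFam M n iv).trace).re with hp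
  have hF : ∀ A : Fin n → Matrix (Fin D) (Fin D) ℂ, (∀ k, (A k).PosSemidef) →
      0 ≤ stateFun ψ A := by
    intro A hA
    rw [stateFun_apply]
    exact trace_mul_nonneg hψ.1 (tProd_posSemidef A hA)
  have hpF : ∀ w, p w = (stateFun ψ (fun k => M (w k))).re := by
    intro w; rw [stateFun_apply]; rfl
  have hone : stateFun ψ (fun _ => 1) = 1 := by
    rw [stateFun_apply]
    have : tProd (fun _ : Fin n => (1 : Matrix (Fin D) (Fin D) ℂ)) = 1 := by
      ext x y
      simp only [tProd, Matrix.of_apply, Matrix.one_apply, Finset.prod_ite_zero]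
      simp [funext_iff]
    rw [this, Matrix.mul_one, hψ.2]
  have hpd : IsProbDist p := by
    refine ⟨fun w => ?_, ?_⟩
    · rw [hpF]; exact (Complex.nonneg_iff.1 (hF _ (fun k => hM.1 _))).1
    · classical
      simp only [hpF]
      rw [← Complex.re_sum, ← MultilinearMap.map_sum (stateFun ψ) (fun (_ : Fin n) i => M i)]
      simp only [hM.2, hone, Complex.one_re]
  -- existence of a state on one system
  have hD : 0 < D := by
    rcases Nat.eq_zero_or_pos D with h0 | h0
    · exfalso
      subst h0
      have hn' : 0 < n := by exact_mod_cast hn0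
      have : IsEmpty (Fin n → Fin 0) := ⟨fun x => (x ⟨0, hn'⟩).elim0⟩
      have := hψ.2
      simp [Matrix.trace] at this
    · exact h0
  have hhd : h * Real.log 2 ≤ Real.log d := by
    have hDc : (D : ℂ) ≠ 0 := by exact_mod_cast hD.ne'
    have hφ : IsDensityMatrix ((((D : ℝ)⁻¹ : ℝ) : ℂ) • (1 : Matrix (Fin D) (Fin D) ℂ)) := by
      refine ⟨Matrix.PosSemidef.one.smul (by rw [Complex.zero_le_real]; positivity), ?_⟩
      rw [Matrix.trace_smul, Matrix.trace_one]
      simp [hDc]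
    exact (mul_le_mul_of_nonneg_right (minOut_le hM hφ) hlog2.le).trans
      (entropy_le (density_output hM hφ) hd)
  set Δ := 8 * L * Real.sqrt (n * l) with hΔ
  have hΔ0 : 0 ≤ Δ := by positivity
  set t : ℝ := Real.exp (-((n * h - Δ) * Real.log 2)) with ht
  have ht0 : 0 < t := Real.exp_pos _
  have hlt : - Real.logb 2 t = n * h - Δ := by
    rw [ht]; unfold Real.logb; rw [Real.log_exp]; field_simp
  rw [ge_iff_le, ← hlt]
  refine smooth_of_tail hpd ht0 ?_ ?_
  · have e : ((Fintype.card (Fin n → I) : ℕ) : ℝ) = Real.exp (n * Real.log d) := by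
      rw [← Real.log_pow, Real.exp_log (by positivity)]
      simp [hdd]
    rw [e, ht, ← Real.exp_add]
    apply Real.one_le_exp
    have := mul_le_mul_of_nonneg_left hhd hn0.le
    have := mul_nonneg hΔ0 hlog2.le
    linarith
  · set σ := Real.sqrt (n * l) with hσ
    have hσ0 : 0 < σ := Real.sqrt_pos.2 (by positivity)
    have hσ2 : σ ^ 2 = n * l := Real.sq_sqrt (by positivity)
    set s : ℝ := σ / (4 * L * n) with hs
    have hs0 : 0 < s := by positivity
    have h1 : ∀ w, p w - min (p w) t ≤ p w ^ (1 + s) * Real.exp (-(s * Real.log t)) := by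
      intro w
      rcases le_or_gt (p w) t with hc | hc
      · rw [min_eq_left hc, sub_self]
        have := hpd.1 w
        positivity
      · have hp0 : 0 < p w := ht0.trans hc
        have e : p w ^ (1 + s) * Real.exp (-(s * Real.log t))
            = p w * Real.exp (s * (Real.log (p w) - Real.log t)) := by
          rw [Real.rpow_add hp0, Real.rpow_one, Real.rpow_def_of_pos hp0, mul_assoc,
            ← Real.exp_add]
          congr 2; ring
        rw [e, min_eq_right hc.le]
        have h2 : 1 ≤ Real.exp (s * (Real.log (p w) - Real.log t)) := by
          apply Real.one_le_exp
          exact mul_nonneg hs0.le (sub_nonneg.2 (Real.log_le_log ht0 hc.le))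
        have := mul_le_mul_of_nonneg_left h2 hp0.le
        linarith
    refine (Finset.sum_le_sum fun w _ => h1 w).trans ?_
    rw [← Finset.sum_mul]
    have h2 := multi_letter hM hd hs0 n (stateFun ψ) hF
    simp only [hone, Complex.one_re, Real.one_rpow, mul_one, ← hpF] at h2
    refine (mul_le_mul_of_nonneg_right h2 (Real.exp_pos _).le).trans ?_
    unfold letterB
    rw [← Real.exp_nat_mul, ← Real.exp_add, ← Real.exp_log hε0, Real.exp_le_exp, hle, ht,
      Real.log_exp, ← hdd, ← hh, hLd]
    have e1 : s * Δ = 2 * l := by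
      rw [hs, hΔ]
      have : σ / (4 * L * n) * (8 * L * σ) = 2 * σ ^ 2 / n := by field_simp; ring
      rw [this, hσ2]; field_simp
    have e2 : n * s ^ 2 = l / (16 * L ^ 2) := by
      rw [hs, div_pow, hσ2]; field_simp; ring
    have hb1 := Real.log_two_gt_d9
    have hb2 := Real.log_two_lt_d9
    have hK : l / (16 * L ^ 2) * (2 * (L * Real.log 2) ^ 2 + 8) ≤ l * Real.log 2 := by
      rw [div_mul_eq_mul_div, div_le_iff₀ (by positivity), mul_assoc]
      apply mul_le_mul_of_nonneg_left _ hl0.le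
      have hL2 : 1 ≤ L ^ 2 := one_le_pow₀ hL1
      have hq : Real.log 2 ^ 2 ≤ 0.5 := by nlinarith
      rw [mul_pow]
      nlinarith
    have e3 : (n : ℝ) * (-s * (h * Real.log 2) + s ^ 2 * (2 * (L * Real.log 2) ^ 2 + 8))
        + -(s * -((n * h - Δ) * Real.log 2))
        = (n * s ^ 2) * (2 * (L * Real.log 2) ^ 2 + 8) - (s * Δ) * Real.log 2 := by ring
    rw [e3, e1, e2]
    linarith

end
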